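/- arXiv:1909.07794 — 4 statements merged into one kernel-verified Lean document; each statement's English description precedes it below -/
import Mathlib

section
/- Let N ∈ ℕ, s₀ ∈ ℂ \ {0}, e₁, …, e_N ∈ ℂ, and let n ≥ 3 be an integer. Suppose a a₁ ≠ 0, γ + m − 1 ≠ 0 for m ∈ {n−2, n−1, n}, and e_k + m − 1 ≠ 0 for all k and m ∈ {n−2, n−1, n}. Let c_{n−3}, c_{n−2}, c_{n−1}, cₙ ∈ ℂ satisfy the two-term relation cₘ = s₀ (S_{m−1}/Rₘ) ∏_{k=1}^N ((e_k + m)/(e_k + m − 1)) c_{m−1} for m ∈ {n−2, n−1, n}. If c_{n−3} ≠ 0 and (n − 3 + α)(n − 3 + β) ≠ 0, then the four-term relation Rₙ cₙ + Q_{n−1} c_{n−1} + P_{n−2} c_{n−2} + S_{n−3} c_{n−3} = 0 holds if and only if Eq. (16) holds at index n. -/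
/-- `Rₙ = a a₁ n (γ + n − 1)`. -/
noncomputable def Rcoef (a a₁ γ : ℂ) (n : ℤ) : ℂ := a * a₁ * n * (γ + n - 1)

/-- `Qₙ = θ₀ − ((γ + n − 1)(a + a₁ + a a₁) + a ε₁ + a₁ ε + a a₁ δ) n`. -/
noncomputable def Qcoef (a a₁ γ δ ε ε₁ θ₀ : ℂ) (n : ℤ) : ℂ :=
  θ₀ - ((γ + n - 1) * (a + a₁ + a * a₁) + a * ε₁ + a₁ * ε + a * a₁ * δ) * n

/-- `Pₙ = θ₁ + ((n + α + β)(1 + a + a₁) − δ − a ε − a₁ ε₁) n`. -/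
noncomputable def Pcoef (a a₁ α β δ ε ε₁ θ₁ : ℂ) (n : ℤ) : ℂ :=
  θ₁ + ((n + α + β) * (1 + a + a₁) - δ - a * ε - a₁ * ε₁) * n

/-- `Sₙ = −(n + α)(n + β)`. -/
noncomputable def Scoef (α β : ℂ) (n : ℤ) : ℂ := -((n + α) * (n + β))

/-- Eq. (16) at index `n`:
`s₀³ S_{n−1} S_{n−2} ∏ (eₖ + n) + s₀² Q_{n−1} S_{n−2} ∏ (eₖ − 1 + n)`
`+ s₀ R_{n−1} P_{n−2} ∏ (eₖ − 2 + n) + R_{n−1} R_{n−2} ∏ (eₖ − 3 + n) = 0`. -/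
def Eq16 (a a₁ α β γ δ ε ε₁ θ₀ θ₁ s₀ : ℂ) {N : ℕ} (e : Fin N → ℂ) (n : ℤ) : Prop :=
  s₀ ^ 3 * Scoef α β (n - 1) * Scoef α β (n - 2) * ∏ k, (e k + (n : ℂ))
    + s₀ ^ 2 * Qcoef a a₁ γ δ ε ε₁ θ₀ (n - 1) * Scoef α β (n - 2)
        * ∏ k, (e k - 1 + (n : ℂ))
    + s₀ * Rcoef a a₁ γ (n - 1) * Pcoef a a₁ α β δ ε ε₁ θ₁ (n - 2)
        * ∏ k, (e k - 2 + (n : ℂ))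
    + Rcoef a a₁ γ (n - 1) * Rcoef a a₁ γ (n - 2) * ∏ k, (e k - 3 + (n : ℂ)) = 0

theorem Rcoef_ne_zero {a a₁ γ : ℂ} {m : ℤ} (haa₁ : a * a₁ ≠ 0) (hm : m ≠ 0)
    (hγ : γ + m - 1 ≠ 0) : Rcoef a a₁ γ m ≠ 0 :=
  mul_ne_zero (mul_ne_zero haa₁ (Int.cast_ne_zero.mpr hm)) hγ

/-- If `c₃, c₂, c₁, c₀` are linked by two-term relations, then the four-term relation between
them is equivalent to a relation between the coefficients alone. -/
theorem four_term_iff_of_two_term {K : Type*} [Field K]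
    {s R₀ R₁ R₂ Q P S₁ S₂ S₃ E₀ E₁ E₂ E₃ c₀ c₁ c₂ c₃ : K}
    (hR₀ : R₀ ≠ 0) (hR₁ : R₁ ≠ 0) (hR₂ : R₂ ≠ 0)
    (hE₁ : E₁ ≠ 0) (hE₂ : E₂ ≠ 0) (hE₃ : E₃ ≠ 0) (hS₃ : S₃ ≠ 0) (hc₃ : c₃ ≠ 0)
    (h₀ : c₀ = s * (S₁ / R₀) * (E₀ / E₁) * c₁)
    (h₁ : c₁ = s * (S₂ / R₁) * (E₁ / E₂) * c₂)
    (h₂ : c₂ = s * (S₃ / R₂) * (E₂ / E₃) * c₃) :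
    R₀ * c₀ + Q * c₁ + P * c₂ + S₃ * c₃ = 0 ↔
      s ^ 3 * S₁ * S₂ * E₀ + s ^ 2 * Q * S₂ * E₁ + s * R₁ * P * E₂ + R₁ * R₂ * E₃ = 0 := by
  have key : R₁ * R₂ * E₃ * (R₀ * c₀ + Q * c₁ + P * c₂ + S₃ * c₃) = S₃ * c₃ *
      (s ^ 3 * S₁ * S₂ * E₀ + s ^ 2 * Q * S₂ * E₁ + s * R₁ * P * E₂ + R₁ * R₂ * E₃) := by
    subst h₂ h₁ h₀
    field_simp
  rw [← mul_eq_zero_iff_left (mul_ne_zero (mul_ne_zero hR₁ hR₂) hE₃), key,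
    mul_eq_zero_iff_left (mul_ne_zero hS₃ hc₃)]

/-- under nondegeneracy conditions, if four consecutive coefficients
`c_{n−3}, …, cₙ` are linked by the two-term ansatz (15), with `c_{n−3} ≠ 0` and
`(n − 3 + α)(n − 3 + β) ≠ 0`, then the four-term recurrence (7) holds at index `n`
iff Eq. (16) holds at index `n`. -/
theorem four_term_iff_eq16
    (a a₁ α β γ δ ε ε₁ θ₀ θ₁ : ℂ) (N : ℕ) (s₀ : ℂ) (hs₀ : s₀ ≠ 0) (e : Fin N → ℂ)
    (n : ℤ) (hn : 3 ≤ n)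
    (haa₁ : a * a₁ ≠ 0)
    (hγ : ∀ m : ℤ, m = n - 2 ∨ m = n - 1 ∨ m = n → γ + m - 1 ≠ 0)
    (he : ∀ k : Fin N, ∀ m : ℤ, m = n - 2 ∨ m = n - 1 ∨ m = n → e k + m - 1 ≠ 0)
    (c : ℤ → ℂ)
    (hc : ∀ m : ℤ, m = n - 2 ∨ m = n - 1 ∨ m = n →
      c m = s₀ * (Scoef α β (m - 1) / Rcoef a a₁ γ m)
              * (∏ k, ((e k + (m : ℂ)) / (e k + (m : ℂ) - 1))) * c (m - 1))
    (hc3 : c (n - 3) ≠ 0)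
    (hαβ : ((n : ℂ) - 3 + α) * ((n : ℂ) - 3 + β) ≠ 0) :
    (Rcoef a a₁ γ n * c n + Qcoef a a₁ γ δ ε ε₁ θ₀ (n - 1) * c (n - 1)
        + Pcoef a a₁ α β δ ε ε₁ θ₁ (n - 2) * c (n - 2)
        + Scoef α β (n - 3) * c (n - 3) = 0)
      ↔ Eq16 a a₁ α β γ δ ε ε₁ θ₀ θ₁ s₀ e n := by
  have hR : ∀ m : ℤ, m = n - 2 ∨ m = n - 1 ∨ m = n → Rcoef a a₁ γ m ≠ 0 :=
    fun m hm => Rcoef_ne_zero haa₁ (by omega) (hγ m hm)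
  have hE : ∀ m : ℤ, m = n - 2 ∨ m = n - 1 ∨ m = n → ∏ k, (e k + (m : ℂ) - 1) ≠ 0 :=
    fun m hm => Finset.prod_ne_zero_iff.mpr fun k _ => he k m hm
  have hS : Scoef α β (n - 3) ≠ 0 := by
    rw [Scoef]
    push_cast
    exact neg_ne_zero.mpr hαβ
  simp only [Finset.prod_div_distrib] at hc
  have s₁ : ∀ k, e k + (n : ℂ) - 1 = e k - 1 + n := fun k => by ring
  have s₂ : ∀ k, e k + ((n - 1 : ℤ) : ℂ) = e k - 1 + n := fun k => by push_cast; ring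
  have s₃ : ∀ k, e k - 1 + (n : ℂ) - 1 = e k - 2 + n := fun k => by ring
  have s₄ : ∀ k, e k + ((n - 2 : ℤ) : ℂ) = e k - 2 + n := fun k => by push_cast; ring
  have s₅ : ∀ k, e k - 2 + (n : ℂ) - 1 = e k - 3 + n := fun k => by ring
  have hE₁ := hE n (by simp)
  have hE₂ := hE (n - 1) (by simp)
  have hE₃ := hE (n - 2) (by simp)
  have h₀ := hc n (by simp)
  have h₁ := hc (n - 1) (by simp)
  have h₂ := hc (n - 2) (by simp)
  rw [show n - 1 - 1 = n - 2 by ring] at h₁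
  rw [show n - 2 - 1 = n - 3 by ring] at h₂
  simp only [s₁, s₂, s₃, s₄, s₅] at hE₁ hE₂ hE₃ h₀ h₁ h₂
  exact four_term_iff_of_two_term (hR n (by simp)) (hR (n - 1) (by simp)) (hR (n - 2) (by simp))
    hE₁ hE₂ hE₃ hS hc3 h₀ h₁ h₂
end

section
/- The polynomial Φ(X) has degree at most N + 4, and its coefficient of X^{N+4} equals (s₀ + a)(s₀ + a₁)(s₀ + a a₁). In particular, if a, a₁ ≠ 0, this coefficient vanishes if and only if s₀ ∈ {−a, −a₁, −a a₁} (Eq. (17)). -/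
open Polynomial

/-- `R(Y) = a a₁ Y (γ + Y − 1)` with a polynomial argument `Y`. -/
noncomputable def Rpol (a a₁ γ : ℂ) (Y : Polynomial ℂ) : Polynomial ℂ :=
  C (a * a₁) * Y * (C γ + Y - 1)

/-- `Q(Y) = θ₀ − ((γ + Y − 1)(a + a₁ + a a₁) + a ε₁ + a₁ ε + a a₁ δ) Y`. -/
noncomputable def Qpol (a a₁ γ δ ε ε₁ θ₀ : ℂ) (Y : Polynomial ℂ) : Polynomial ℂ :=
  C θ₀ - ((C γ + Y - 1) * C (a + a₁ + a * a₁) + C (a * ε₁ + a₁ * ε + a * a₁ * δ)) * Y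

/-- `P(Y) = θ₁ + ((Y + α + β)(1 + a + a₁) − δ − a ε − a₁ ε₁) Y`. -/
noncomputable def Ppol (a a₁ α β δ ε ε₁ θ₁ : ℂ) (Y : Polynomial ℂ) : Polynomial ℂ :=
  C θ₁ + ((Y + C (α + β)) * C (1 + a + a₁) - C (δ + a * ε + a₁ * ε₁)) * Y

/-- `S(Y) = −(Y + α)(Y + β)`. -/
noncomputable def Spol (α β : ℂ) (Y : Polynomial ℂ) : Polynomial ℂ :=
  -((Y + C α) * (Y + C β))

/-- The polynomial `Φ(X)`: the left-hand side of Eq. (16) with the integer index `n`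
replaced by the indeterminate `X`. -/
noncomputable def Phi (a a₁ α β γ δ ε ε₁ θ₀ θ₁ s₀ : ℂ) {N : ℕ} (e : Fin N → ℂ) :
    Polynomial ℂ :=
  C s₀ ^ 3 * Spol α β (X - 1) * Spol α β (X - 2) * ∏ k, (C (e k) + X)
    + C s₀ ^ 2 * Qpol a a₁ γ δ ε ε₁ θ₀ (X - 1) * Spol α β (X - 2)
        * ∏ k, (C (e k) - 1 + X)
    + C s₀ * Rpol a a₁ γ (X - 1) * Ppol a a₁ α β δ ε ε₁ θ₁ (X - 2)
        * ∏ k, (C (e k) - 2 + X)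
    + Rpol a a₁ γ (X - 1) * Rpol a a₁ γ (X - 2) * ∏ k, (C (e k) - 3 + X)

/-- Leading-term bookkeeping: `p` has degree at most `n` and `X ^ n`-coefficient `c`. -/
def HasTop (p : ℂ[X]) (n : ℕ) (c : ℂ) : Prop :=
  p.natDegree ≤ n ∧ p.coeff n = c

theorem HasTop.mul {p q : ℂ[X]} {m n : ℕ} {c d : ℂ} (hp : HasTop p m c) (hq : HasTop q n d) :
    HasTop (p * q) (m + n) (c * d) :=
  ⟨natDegree_mul_le_of_le hp.1 hq.1, by
    rw [coeff_mul_add_eq_of_natDegree_le hp.1 hq.1, hp.2, hq.2]⟩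

theorem HasTop.add {p q : ℂ[X]} {n : ℕ} {c d : ℂ} (hp : HasTop p n c) (hq : HasTop q n d) :
    HasTop (p + q) n (c + d) :=
  ⟨natDegree_add_le_of_degree_le hp.1 hq.1, by rw [coeff_add, hp.2, hq.2]⟩

theorem HasTop.neg {p : ℂ[X]} {n : ℕ} {c : ℂ} (hp : HasTop p n c) : HasTop (-p) n (-c) :=
  ⟨by rw [natDegree_neg]; exact hp.1, by rw [coeff_neg, hp.2]⟩

theorem HasTop.add_C {p : ℂ[X]} {n : ℕ} {c : ℂ} (hp : HasTop p (n + 1) c) (b : ℂ) :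
    HasTop (p + C b) (n + 1) c :=
  ⟨by rw [natDegree_add_C]; exact hp.1, by rw [coeff_add, coeff_C_succ, add_zero, hp.2]⟩

theorem hasTop_C (c : ℂ) : HasTop (C c) 0 c :=
  ⟨(natDegree_C c).le, coeff_C_zero⟩

theorem hasTop_X_add_C (b : ℂ) : HasTop (X + C b) 1 1 :=
  ⟨(natDegree_X_add_C b).le, by simp⟩

theorem hasTop_prod {N : ℕ} (f : Fin N → ℂ) : HasTop (∏ k, (X + C (f k))) N 1 := by
  have hdeg : (∏ k, (X + C (f k))).natDegree = N := by
    rw [natDegree_prod_of_monic _ _ fun k _ => monic_X_add_C (f k)]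
    simp
  have hmonic : (∏ k, (X + C (f k))).Monic :=
    monic_prod_of_monic _ _ fun k _ => monic_X_add_C (f k)
  refine ⟨hdeg.le, ?_⟩
  simpa only [Monic, leadingCoeff, hdeg] using hmonic

theorem hasTop_Rpol (a a₁ γ : ℂ) {Y : ℂ[X]} (hY : HasTop Y 1 1) :
    HasTop (Rpol a a₁ γ Y) 2 (a * a₁) := by
  have h := ((hasTop_C (a * a₁)).mul hY).mul (hY.add_C (γ - 1))
  convert h using 1
  · simp only [Rpol, C_sub, C_1]; ring
  · ring

theorem hasTop_Qpol (a a₁ γ δ ε ε₁ θ₀ : ℂ) {Y : ℂ[X]} (hY : HasTop Y 1 1) :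
    HasTop (Qpol a a₁ γ δ ε ε₁ θ₀ Y) 2 (-(a + a₁ + a * a₁)) := by
  have h := ((((hY.add_C (γ - 1)).mul (hasTop_C (a + a₁ + a * a₁))).add_C
    (a * ε₁ + a₁ * ε + a * a₁ * δ)).mul hY).neg.add_C θ₀
  convert h using 1
  · simp only [Qpol, C_sub, C_1]; ring
  · ring

theorem hasTop_Ppol (a a₁ α β δ ε ε₁ θ₁ : ℂ) {Y : ℂ[X]} (hY : HasTop Y 1 1) :
    HasTop (Ppol a a₁ α β δ ε ε₁ θ₁ Y) 2 (1 + a + a₁) := by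
  have h := ((((hY.add_C (α + β)).mul (hasTop_C (1 + a + a₁))).add_C
    (-(δ + a * ε + a₁ * ε₁))).mul hY).add_C θ₁
  convert h using 1
  · simp only [Ppol, C_neg]; ring
  · ring

theorem hasTop_Spol (α β : ℂ) {Y : ℂ[X]} (hY : HasTop Y 1 1) :
    HasTop (Spol α β Y) 2 (-1) := by
  simpa [Spol] using ((hY.add_C α).mul (hY.add_C β)).neg

theorem hasTop_Phi (a a₁ α β γ δ ε ε₁ θ₀ θ₁ s₀ : ℂ) {N : ℕ} (e : Fin N → ℂ) :
    HasTop (Phi a a₁ α β γ δ ε ε₁ θ₀ θ₁ s₀ e) (4 + N)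
      ((s₀ + a) * (s₀ + a₁) * (s₀ + a * a₁)) := by
  have h₁ : HasTop (X - 1 : ℂ[X]) 1 1 := by
    simpa [sub_eq_add_neg] using hasTop_X_add_C (-1)
  have h₂ : HasTop (X - 2 : ℂ[X]) 1 1 := by
    simpa only [sub_eq_add_neg, C_neg, C_ofNat] using hasTop_X_add_C (-2)
  have hprod (c : ℂ) : HasTop (∏ k, (C (e k) - C c + X)) N 1 := by
    simpa only [C_sub, add_comm] using hasTop_prod fun k => e k - c
  have hR₁ := hasTop_Rpol a a₁ γ h₁
  have hR₂ := hasTop_Rpol a a₁ γ h₂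
  have hS₂ := hasTop_Spol α β h₂
  have h := ((((((hasTop_C (s₀ ^ 3)).mul (hasTop_Spol α β h₁)).mul hS₂).mul (hprod 0)).add
    ((((hasTop_C (s₀ ^ 2)).mul (hasTop_Qpol a a₁ γ δ ε ε₁ θ₀ h₁)).mul hS₂).mul (hprod 1))).add
    ((((hasTop_C s₀).mul hR₁).mul (hasTop_Ppol a a₁ α β δ ε ε₁ θ₁ h₂)).mul (hprod 2))).add
    ((hR₁.mul hR₂).mul (hprod 3))
  convert h using 1
  · simp only [Phi, C_pow, C_0, sub_zero, C_1, C_ofNat]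
  · ring

/-- `Φ(X)` has degree at most `N + 4`, its coefficient of `X^{N+4}` is
`(s₀ + a)(s₀ + a₁)(s₀ + a a₁)`, and, when `a, a₁ ≠ 0`, this coefficient vanishes iff
`s₀ ∈ {−a, −a₁, −a a₁}` (Eq. (17)). -/
theorem phi_degree_and_top_coeff
    (a a₁ α β γ δ ε ε₁ θ₀ θ₁ s₀ : ℂ) (N : ℕ) (e : Fin N → ℂ) :
    (Phi a a₁ α β γ δ ε ε₁ θ₀ θ₁ s₀ e).degree ≤ (N + 4 : ℕ) ∧
    (Phi a a₁ α β γ δ ε ε₁ θ₀ θ₁ s₀ e).coeff (N + 4)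
      = (s₀ + a) * (s₀ + a₁) * (s₀ + a * a₁) ∧
    (a ≠ 0 → a₁ ≠ 0 →
      ((Phi a a₁ α β γ δ ε ε₁ θ₀ θ₁ s₀ e).coeff (N + 4) = 0
        ↔ s₀ = -a ∨ s₀ = -a₁ ∨ s₀ = -(a * a₁))) := by
  have h := hasTop_Phi a a₁ α β γ δ ε ε₁ θ₀ θ₁ s₀ e
  rw [add_comm 4 N] at h
  refine ⟨natDegree_le_iff_degree_le.mp h.1, h.2, fun _ _ => ?_⟩
  rw [h.2, mul_eq_zero, mul_eq_zero, or_assoc]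
  simp only [add_eq_zero_iff_eq_neg]
end

section
/- Assume s₀ = −a a₁, a, a₁ ∉ {0, 1}, and the Fuchs condition 1 + α + β = γ + δ + ε + ε₁. Then the coefficient of X^{N+3} in the polynomial Φ(X) vanishes if and only if ε + ε₁ = −N (Eq. (18)). -/
open Polynomial

/-- Multiplying a polynomial of degree at most `m + 1` by monic linear factors: bound on the degree
and the two leading coefficients of the result. -/
lemma natDegree_le_and_coeff_mul_prod_C_add_X {R ι : Type*} [CommRing R] (f : R[X]) (m : ℕ)
    (hf : f.natDegree ≤ m + 1) (u : ι → R) (s : Finset ι) :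
    (f * ∏ k ∈ s, (C (u k) + X)).natDegree ≤ s.card + m + 1 ∧
      (f * ∏ k ∈ s, (C (u k) + X)).coeff (s.card + m + 1) = f.coeff (m + 1) ∧
      (f * ∏ k ∈ s, (C (u k) + X)).coeff (s.card + m) =
        f.coeff m + f.coeff (m + 1) * ∑ k ∈ s, u k := by
  classical
  induction s using Finset.induction_on with
  | empty => simpa using hf
  | insert i s hi ih =>
    obtain ⟨hdeg, htop, hsub⟩ := ih
    rw [Finset.prod_insert hi, Finset.sum_insert hi, Finset.card_insert_of_notMem hi,
      mul_left_comm]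
    set g := f * ∏ k ∈ s, (C (u k) + X)
    have hzero : g.coeff (s.card + m + 1 + 1) = 0 :=
      coeff_eq_zero_of_natDegree_lt (by omega)
    rw [show s.card + 1 + m = s.card + m + 1 by omega]
    refine ⟨?_, ?_, ?_⟩
    · refine natDegree_mul_le.trans ?_
      have hlin : (C (u i) + X : R[X]).natDegree ≤ 1 := by compute_degree
      omega
    · rw [add_mul, coeff_add, coeff_C_mul, coeff_X_mul, hzero, htop]
      ring
    · rw [add_mul, coeff_add, coeff_C_mul, coeff_X_mul, htop, hsub]
      ring

/-- The coefficient of `X ^ (N + 3)` in a product of two quadratics and `N` monic linear factors. -/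
lemma coeff_quadratic_mul_quadratic_mul_prod {R : Type*} [CommRing R] {N : ℕ}
    (a₂ a₁ a₀ b₂ b₁ b₀ : R) (u : Fin N → R) :
    ((C a₂ * X ^ 2 + C a₁ * X + C a₀) * (C b₂ * X ^ 2 + C b₁ * X + C b₀) *
        ∏ k, (C (u k) + X)).coeff (N + 3) =
      a₂ * b₁ + a₁ * b₂ + a₂ * b₂ * ∑ k, u k := by
  have hexpand : (C a₂ * X ^ 2 + C a₁ * X + C a₀) * (C b₂ * X ^ 2 + C b₁ * X + C b₀) =
      C (a₂ * b₂) * X ^ 4 + C (a₂ * b₁ + a₁ * b₂) * X ^ 3 +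
        C (a₂ * b₀ + a₁ * b₁ + a₀ * b₂) * X ^ 2 + C (a₁ * b₀ + a₀ * b₁) * X +
        C (a₀ * b₀) := by
    simp only [C_add, C_mul]
    ring
  have hdeg : (C (a₂ * b₂) * X ^ 4 + C (a₂ * b₁ + a₁ * b₂) * X ^ 3 +
        C (a₂ * b₀ + a₁ * b₁ + a₀ * b₂) * X ^ 2 + C (a₁ * b₀ + a₀ * b₁) * X +
        C (a₀ * b₀)).natDegree ≤ 3 + 1 := by
    compute_degree
  have hcoeff := (natDegree_le_and_coeff_mul_prod_C_add_X _ 3 hdeg u Finset.univ).2.2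
  rw [Finset.card_univ, Fintype.card_fin] at hcoeff
  rw [hexpand, hcoeff]
  simp [-map_mul, -map_add, coeff_X_pow]

lemma Rpol_X_sub_C (a a₁ γ t : ℂ) :
    Rpol a a₁ γ (X - C t) = C (a * a₁) * X ^ 2 + C (a * a₁ * (γ - 1 - 2 * t)) * X +
      C (a * a₁ * (t * (t + 1 - γ))) := by
  simp only [Rpol, C_add, C_mul, C_sub, C_1, C_ofNat]
  ring

lemma Qpol_X_sub_C (a a₁ γ δ ε ε₁ θ₀ t : ℂ) :
    Qpol a a₁ γ δ ε ε₁ θ₀ (X - C t) =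
      C (-(a + a₁ + a * a₁)) * X ^ 2 +
      C (-((a + a₁ + a * a₁) * (γ - 1 - 2 * t) + (a * ε₁ + a₁ * ε + a * a₁ * δ))) * X +
      C (θ₀ + t * ((γ - t - 1) * (a + a₁ + a * a₁) + (a * ε₁ + a₁ * ε + a * a₁ * δ))) := by
  simp only [Qpol, C_add, C_mul, C_sub, C_neg, C_1, C_ofNat]
  ring

lemma Ppol_X_sub_C (a a₁ α β δ ε ε₁ θ₁ t : ℂ) :
    Ppol a a₁ α β δ ε ε₁ θ₁ (X - C t) =
      C (1 + a + a₁) * X ^ 2 +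
      C ((1 + a + a₁) * (α + β - 2 * t) - (δ + a * ε + a₁ * ε₁)) * X +
      C (θ₁ - t * ((α + β - t) * (1 + a + a₁) - (δ + a * ε + a₁ * ε₁))) := by
  simp only [Ppol, C_add, C_mul, C_sub, C_1, C_ofNat]
  ring

lemma Spol_X_sub_C (α β t : ℂ) :
    Spol α β (X - C t) = C (-1) * X ^ 2 + C (-(α + β - 2 * t)) * X +
      C (-((α - t) * (β - t))) := by
  simp only [Spol, C_add, C_mul, C_sub, C_neg, C_1, C_ofNat]
  ring

/-- Under the Fuchs condition and `s₀ = -a a₁`, the subleading coefficient of `Φ` factors. -/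
lemma coeff_Phi (a a₁ α β γ δ ε ε₁ θ₀ θ₁ : ℂ) {N : ℕ} (e : Fin N → ℂ)
    (hfuchs : 1 + α + β = γ + δ + ε + ε₁) :
    (Phi a a₁ α β γ δ ε ε₁ θ₀ θ₁ (-(a * a₁)) e).coeff (N + 3) =
      -((a * a₁) ^ 2 * ((a - 1) * (a₁ - 1)) * (ε + ε₁ + N)) := by
  have hshift (t : ℂ) : ∑ k, (e k - t) = ∑ k, e k - N * t := by
    simp [Finset.sum_sub_distrib]
  have hPhi : Phi a a₁ α β γ δ ε ε₁ θ₀ θ₁ (-(a * a₁)) e =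
      C ((-(a * a₁)) ^ 3) * (Spol α β (X - C 1) * Spol α β (X - C 2) * ∏ k, (C (e k) + X)) +
      C ((-(a * a₁)) ^ 2) * (Qpol a a₁ γ δ ε ε₁ θ₀ (X - C 1) * Spol α β (X - C 2) *
        ∏ k, (C (e k - 1) + X)) +
      C (-(a * a₁)) * (Rpol a a₁ γ (X - C 1) * Ppol a a₁ α β δ ε ε₁ θ₁ (X - C 2) *
        ∏ k, (C (e k - 2) + X)) +
      Rpol a a₁ γ (X - C 1) * Rpol a a₁ γ (X - C 2) * ∏ k, (C (e k - 3) + X) := by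
    simp only [Phi, C_sub, C_1, C_ofNat, C_pow, mul_assoc]
  rw [hPhi]
  simp only [Rpol_X_sub_C, Qpol_X_sub_C, Ppol_X_sub_C, Spol_X_sub_C, coeff_add, coeff_C_mul,
    coeff_quadratic_mul_quadratic_mul_prod, hshift]
  obtain rfl : γ = 1 + α + β - δ - ε - ε₁ := by linear_combination -hfuchs
  ring

/-- with `s₀ = −a a₁`, `a, a₁ ∉ {0, 1}` and the Fuchs condition
`1 + α + β = γ + δ + ε + ε₁`, the coefficient of `X^{N+3}` in `Φ(X)` vanishes iff
`ε + ε₁ = −N` (Eq. (18)). -/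
theorem phi_subtop_coeff_vanishes_iff
    (a a₁ α β γ δ ε ε₁ θ₀ θ₁ s₀ : ℂ) (N : ℕ) (e : Fin N → ℂ)
    (hs₀ : s₀ = -(a * a₁))
    (ha0 : a ≠ 0) (ha1 : a ≠ 1) (ha₁0 : a₁ ≠ 0) (ha₁1 : a₁ ≠ 1)
    (hfuchs : 1 + α + β = γ + δ + ε + ε₁) :
    (Phi a a₁ α β γ δ ε ε₁ θ₀ θ₁ s₀ e).coeff (N + 3) = 0 ↔ ε + ε₁ = -(N : ℂ) := by
  subst hs₀
  have hfactor : (a * a₁) ^ 2 * ((a - 1) * (a₁ - 1)) ≠ 0 :=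
    mul_ne_zero (pow_ne_zero 2 (mul_ne_zero ha0 ha₁0))
      (mul_ne_zero (sub_ne_zero.mpr ha1) (sub_ne_zero.mpr ha₁1))
  rw [coeff_Phi a a₁ α β γ δ ε ε₁ θ₀ θ₁ e hfuchs, neg_eq_zero, mul_eq_zero_iff_left hfactor,
    add_eq_zero_iff_eq_neg]
end

section
/- Let a, a₁, α, β, γ, θ₀, e₁ ∈ ℂ with a₁ ≠ 0 and e₁ ≠ 0. If a(α − e₁)(β − e₁) + (γ − 1 − e₁)e₁ = 0 and θ₀ = −a a₁ αβ (1 + e₁)/e₁, then θ₀ satisfies the quadratic equation θ₀²/a₁² + (1 + a(α + β + 2αβ) − γ) θ₀/a₁ + aαβ(a(1 + α)(1 + β) − γ) = 0 (Eq. (24)). -/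
/-- elimination of the auxiliary parameter `e₁` from Eqs. (22)–(23):
if `a₁ ≠ 0`, `e₁ ≠ 0`, `a(α − e₁)(β − e₁) + (γ − 1 − e₁)e₁ = 0` and
`θ₀ = −a a₁ αβ (1 + e₁)/e₁`, then `θ₀` satisfies the quadratic equation (24):
`θ₀²/a₁² + (1 + a(α + β + 2αβ) − γ) θ₀/a₁ + aαβ(a(1 + α)(1 + β) − γ) = 0`. -/
theorem theta0_quadratic_N_one
    (a a₁ α β γ θ₀ e₁ : ℂ) (ha₁ : a₁ ≠ 0) (he₁ : e₁ ≠ 0)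
    (heq23 : a * (α - e₁) * (β - e₁) + (γ - 1 - e₁) * e₁ = 0)
    (hθ₀ : θ₀ = -(a * a₁ * (α * β)) * (1 + e₁) / e₁) :
    θ₀ ^ 2 / a₁ ^ 2 + (1 + a * (α + β + 2 * (α * β)) - γ) * (θ₀ / a₁)
      + a * (α * β) * (a * (1 + α) * (1 + β) - γ) = 0 := by
  subst hθ₀
  field_simp
  linear_combination a * α * β * heq23
end
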